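/- For n ≥ 2 the value −5/3 is an eigenvalue of the Hanoi graph Laplacian Δ^H_n with multiplicity (3^{n−1}−1)/2, and a basis of the eigenspace is given by functions taking alternating values ±1 around cycles of H_n surrounding the holes of the graph (cycles strictly longer than the elementary triangles). -/

import Mathlib

noncomputable section
attribute [local instance] Classical.propDecidable

/-- Adjacency in the level-`n` Hanoi towers Schreier graph, whose vertices are
the words `w ∈ {1,2,3}^n`: `w ∼ w'` iff `w = u·i·jj⋯j` and `w' = u·j·ii⋯i`
for some letters `i ≠ j` (they agree before position `k`, differ there, and
afterwards `w` is constantly `w' k` and `w'` is constantly `w k`). -/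
def adjHW {n : ℕ} (w w' : Fin n → Fin 3) : Prop :=
  ∃ k : Fin n, w k ≠ w' k ∧ (∀ m : Fin n, m < k → w m = w' m) ∧
    (∀ m : Fin n, k < m → w m = w' k) ∧ (∀ m : Fin n, k < m → w' m = w k)

/-- The graph Laplacian of `H_n` as a matrix:
`Δf(w) = (1/3) Σ_{w' ∼ w} (f(w') - f(w))`; `H_n` is 3-regular once the loops at
the three constant words are counted, and a loop contributes `0` to the sum. -/
def lapHW (n : ℕ) : Matrix (Fin n → Fin 3) (Fin n → Fin 3) ℝ :=
  Matrix.of fun w w' =>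
    (3 : ℝ)⁻¹ * ((if adjHW w w' then 1 else 0) -
      (if w' = w then ∑ u : Fin n → Fin 3, (if adjHW w u then (1 : ℝ) else 0) else 0))

/-- `g` takes alternating values `±1` around a cycle of `H_n` of length `2k ≥ 4`
(so strictly longer than the elementary triangles) and vanishes elsewhere. -/
def IsAltCycleFn (n : ℕ) (g : (Fin n → Fin 3) → ℝ) : Prop :=
  ∃ k : ℕ, 2 ≤ k ∧ ∃ v : ZMod (2 * k) → (Fin n → Fin 3),
    Function.Injective v ∧
    (∀ m : ZMod (2 * k), adjHW (v m) (v (m + 1))) ∧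
    (∀ w, w ∉ Set.range v → g w = 0) ∧
    ∀ m : ZMod (2 * k), g (v m) = (-1 : ℝ) ^ m.val

/-- The divergence at `v` sums a function on darts over the darts based at `v`. -/
def divergence {W V : Type*} [Fintype W] (t : W → V) : (W → ℝ) →ₗ[ℝ] (V → ℝ) where
  toFun g v := ∑ w, if t w = v then g w else 0
  map_add' f g := by
    ext v
    simp only [Pi.add_apply, ← Finset.sum_add_distrib]
    exact Finset.sum_congr rfl fun w _ => by split_ifs <;> simp
  map_smul' c g := by
    ext v
    simp only [Pi.smul_apply, smul_eq_mul, Finset.mul_sum, RingHom.id_apply]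
    exact Finset.sum_congr rfl fun w _ => by split_ifs <;> simp

lemma divergence_apply {W V : Type*} [Fintype W] (t : W → V) (g : W → ℝ) (v : V) :
    divergence t g v = ∑ w, if t w = v then g w else 0 := rfl

lemma divergence_single {W V : Type*} [Fintype W] (t : W → V) (w : W) :
    divergence t (Pi.single w 1) = Pi.single (t w) 1 := by
  ext v
  rw [divergence_apply, Finset.sum_eq_single w]
  · simp [Pi.single_apply, eq_comm]
  · intro x _ hx
    simp [hx]
  · simp

/-- Functions that change sign under `σ`. -/
def antiInvariant {W : Type*} (σ : W → W) : Submodule ℝ (W → ℝ) where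
  carrier := {g | ∀ w, g (σ w) = -g w}
  add_mem' {f g} hf hg w := by simp [hf w, hg w]; ring
  zero_mem' w := by simp
  smul_mem' c g hg w := by simp [hg w]

lemma mem_antiInvariant {W : Type*} {σ : W → W} {g : W → ℝ} :
    g ∈ antiInvariant σ ↔ ∀ w, g (σ w) = -g w := Iff.rfl

/-- Sign-changing functions without divergence. -/
def flowSpace {W V : Type*} [Fintype W] (t : W → V) (σ : W → W) : Submodule ℝ (W → ℝ) :=
  antiInvariant σ ⊓ LinearMap.ker (divergence t)

lemma mem_flowSpace {W V : Type*} [Fintype W] {t : W → V} {σ : W → W} {g : W → ℝ} :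
    g ∈ flowSpace t σ ↔
      (∀ w, g (σ w) = -g w) ∧ ∀ v, ∑ w, (if t w = v then g w else 0) = 0 := by
  rw [flowSpace, Submodule.mem_inf, mem_antiInvariant, LinearMap.mem_ker, funext_iff]
  rfl

lemma two_mul_finrank_antiInvariant {W : Type*} [Fintype W] {σ : W → W}
    (hσ : Function.Involutive σ) :
    2 * Module.finrank ℝ (antiInvariant σ) + Nat.card {w // σ w = w} = Fintype.card W := by
  have hproj : LinearMap.IsProj (antiInvariant σ)
      ((2 : ℝ)⁻¹ • (LinearMap.id - LinearMap.funLeft ℝ ℝ σ)) := by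
    constructor
    · intro g w
      simp [LinearMap.funLeft_apply, hσ w]
      ring
    · intro g hg
      ext w
      simp [LinearMap.funLeft_apply, mem_antiInvariant.1 hg w]
      ring
  have htr : LinearMap.trace ℝ (W → ℝ) (LinearMap.funLeft ℝ ℝ σ)
      = Nat.card {w // σ w = w} := by
    rw [LinearMap.trace_eq_matrix_trace ℝ (Pi.basisFun ℝ W), Matrix.trace,
      Nat.card_eq_fintype_card, Fintype.card_subtype,
      Finset.card_filter, Nat.cast_sum]
    refine Finset.sum_congr rfl fun w _ => ?_
    simp [LinearMap.funLeft_apply, Pi.single_apply]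
  have h := hproj.trace
  rw [map_smul, map_sub, htr, LinearMap.trace_id, Module.finrank_fintype_fun_eq_card,
    smul_eq_mul] at h
  have : (2 : ℝ) * Module.finrank ℝ (antiInvariant σ) + Nat.card {w // σ w = w}
      = Fintype.card W := by rw [← h]; ring
  exact_mod_cast this

/-- If every function on `V` invariant along darts is constant, the divergences of sign-changing
functions are exactly the functions of total sum zero. -/
lemma map_divergence_antiInvariant {W V : Type*} [Fintype W] [Fintype V] {t : W → V} {σ : W → W}
    (hσ : Function.Involutive σ)
    (hconn : ∀ u v, Relation.EqvGen (fun a b => ∃ w, t w = a ∧ t (σ w) = b) u v) :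
    (antiInvariant σ).map (divergence t)
      = LinearMap.ker (∑ v : V, LinearMap.proj v : (V → ℝ) →ₗ[ℝ] ℝ) := by
  have key : ∀ u v, (Pi.single u 1 - Pi.single v 1 : V → ℝ)
      ∈ (antiInvariant σ).map (divergence t) := by
    intro u v
    induction hconn u v with
    | rel a b h =>
      obtain ⟨w, rfl, rfl⟩ := h
      refine ⟨Pi.single w 1 - Pi.single (σ w) 1, fun x => ?_, ?_⟩
      · have h1 : σ x = w ↔ x = σ w := ⟨fun h => by rw [← h, hσ], fun h => by rw [h, hσ]⟩
        simp [Pi.single_apply, h1, hσ.injective.eq_iff]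
      · rw [map_sub, divergence_single, divergence_single]
    | refl a => simp
    | symm a b _ ih => simpa using neg_mem ih
    | trans a b c _ _ h1 h2 => simpa using add_mem h1 h2
  apply le_antisymm
  · rintro _ ⟨g, hg, rfl⟩
    have h1 : ∑ v, divergence t g v = ∑ w, g w := by
      simp only [divergence_apply]
      rw [Finset.sum_comm]
      simp
    have h2 : ∑ w, g w = -∑ w, g w := by
      rw [← Finset.sum_neg_distrib, ← hσ.bijective.sum_comp g]
      exact Finset.sum_congr rfl fun w _ => hg w
    simp only [LinearMap.mem_ker, LinearMap.sum_apply, LinearMap.proj_apply]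
    linarith
  · intro f hf
    simp only [LinearMap.mem_ker, LinearMap.sum_apply, LinearMap.proj_apply] at hf
    rcases isEmpty_or_nonempty V with hV | ⟨⟨v₀⟩⟩
    · rw [Subsingleton.elim f 0]; exact zero_mem _
    have : f = ∑ v, f v • (Pi.single v 1 - Pi.single v₀ 1 : V → ℝ) := by
      simp only [smul_sub, Finset.sum_sub_distrib, ← Finset.sum_smul, hf, zero_smul, sub_zero]
      ext x
      simp [Finset.sum_apply, Pi.single_apply]
    rw [this]
    exact Submodule.sum_mem _ fun v _ => Submodule.smul_mem _ _ (key _ _)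

lemma finrank_ker_sum_proj {V : Type*} [Fintype V] [Nonempty V] :
    Module.finrank ℝ (LinearMap.ker (∑ v : V, LinearMap.proj v : (V → ℝ) →ₗ[ℝ] ℝ)) + 1
      = Fintype.card V := by
  have h := LinearMap.finrank_range_add_finrank_ker
    (∑ v : V, LinearMap.proj v : (V → ℝ) →ₗ[ℝ] ℝ)
  have hs : LinearMap.range (∑ v : V, LinearMap.proj v : (V → ℝ) →ₗ[ℝ] ℝ) = ⊤ := by
    obtain ⟨v₀⟩ := ‹Nonempty V›
    refine LinearMap.range_eq_top.2 fun c => ⟨Pi.single v₀ c, ?_⟩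
    simp [LinearMap.sum_apply]
  rw [hs, finrank_top, Module.finrank_self, Module.finrank_fintype_fun_eq_card] at h
  omega

lemma two_mul_finrank_flowSpace {W V : Type*} [Fintype W] [Fintype V] [Nonempty V]
    {t : W → V} {σ : W → W} (hσ : Function.Involutive σ)
    (hconn : ∀ u v, Relation.EqvGen (fun a b => ∃ w, t w = a ∧ t (σ w) = b) u v) :
    2 * Module.finrank ℝ (flowSpace t σ) + 2 * Fintype.card V + Nat.card {w // σ w = w}
      = Fintype.card W + 2 := by
  have h1 := two_mul_finrank_antiInvariant hσ
  have h2 := LinearMap.finrank_range_add_finrank_ker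
    ((divergence t).domRestrict (antiInvariant σ))
  rw [LinearMap.range_domRestrict, map_divergence_antiInvariant hσ hconn,
    LinearMap.ker_domRestrict] at h2
  have h3 : Module.finrank ℝ
      ((LinearMap.ker (divergence t)).comap (antiInvariant σ).subtype)
      = Module.finrank ℝ (flowSpace t σ) := by
    rw [← Submodule.finrank_map_subtype_eq, Submodule.map_comap_subtype]
    rfl
  have h4 := finrank_ker_sum_proj (V := V)
  omega

/-- Flows are the functions with `S (t w) + g w + g (σ w) = 0`, where `S` is the divergence. -/
lemma mem_flowSpace_iff_divergence_add {W V : Type*} [Fintype W] [Fintype V] [Nonempty V]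
    {t : W → V} {σ : W → W} (hσ : Function.Involutive σ)
    (hconn : ∀ u v, Relation.EqvGen (fun a b => ∃ w, t w = a ∧ t (σ w) = b) u v)
    (hW : 0 < Fintype.card W) (g : W → ℝ) :
    g ∈ flowSpace t σ ↔ ∀ w, divergence t g (t w) + g w + g (σ w) = 0 := by
  constructor
  · intro hg w
    rw [LinearMap.mem_ker.1 hg.2, hg.1 w]
    simp
  · intro h
    have hconst : ∀ u v, divergence t g u = divergence t g v := by
      intro u v
      induction hconn u v with
      | rel a b h' =>
        obtain ⟨w, rfl, rfl⟩ := h'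
        have h1 := h w
        have h2 := h (σ w)
        rw [hσ] at h2
        linarith
      | refl a => rfl
      | symm a b _ ih => exact ih.symm
      | trans a b c _ _ h1 h2 => exact h1.trans h2
    obtain ⟨v₀⟩ := ‹Nonempty V›
    have hsum : ∑ v, divergence t g v = ∑ w, g w := by
      simp only [divergence_apply]
      rw [Finset.sum_comm]
      simp
    have htot : ∑ w, (divergence t g v₀ + g w + g (σ w)) = 0 :=
      Finset.sum_eq_zero fun w _ => by rw [hconst v₀ (t w)]; exact h w
    rw [Finset.sum_add_distrib, Finset.sum_add_distrib, hσ.bijective.sum_comp g, ← hsum,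
      Finset.sum_congr rfl fun v _ => hconst v v₀] at htot
    simp only [Finset.sum_const, Finset.card_univ, nsmul_eq_mul] at htot
    have hW' : (0 : ℝ) < Fintype.card W := by exact_mod_cast hW
    have h0 : divergence t g v₀ = 0 := by
      have : ((Fintype.card W : ℝ) + 2 * Fintype.card V) * divergence t g v₀ = 0 := by linarith
      exact (mul_eq_zero.1 this).resolve_left (by positivity)
    have hz : ∀ v, divergence t g v = 0 := fun v => (hconst v v₀).trans h0
    refine ⟨fun w => ?_, LinearMap.mem_ker.2 (funext hz)⟩
    have := h w
    rw [hz] at this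
    linarith

/-- A nonzero flow carries a closed orbit of positive darts, each based where the previous one
ends. -/
lemma exists_positive_cycle {W V : Type*} [Fintype W] {t : W → V} {σ : W → W} {g : W → ℝ}
    (hg : g ∈ flowSpace t σ) (hg0 : g ≠ 0) :
    ∃ (k : ℕ) (c : ℕ → W), 0 < k ∧ (∀ i, 0 < g (c i)) ∧ (∀ i, t (c (i + 1)) = t (σ (c i))) ∧
      (∀ i, c (i + k) = c i) ∧ Set.InjOn c (Set.Iio k) := by
  obtain ⟨ha, hd⟩ := mem_flowSpace.1 hg
  have hnext : ∀ w : {w // 0 < g w}, ∃ w' : {w // 0 < g w}, t w' = t (σ w) := by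
    rintro ⟨w, hw⟩
    by_contra! hcon
    have hle : ∀ x, (if t x = t (σ w) then g x else 0) ≤ 0 := by
      intro x
      split_ifs with hx
      · by_contra! hpos
        exact hcon ⟨x, hpos⟩ hx
      · exact le_rfl
    have := (Finset.sum_eq_zero_iff_of_nonpos fun x _ => hle x).1 (hd (t (σ w))) (σ w)
      (Finset.mem_univ _)
    simp [ha w] at this
    linarith
  choose f hf using hnext
  obtain ⟨x₀⟩ : Nonempty {w // 0 < g w} := by
    obtain ⟨w, hw⟩ := Function.ne_iff.1 hg0
    rcases lt_or_gt_of_ne hw with h | h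
    · exact ⟨σ w, by rw [ha w]; simpa using h⟩
    · exact ⟨w, h⟩
  obtain ⟨i, j, hij, he⟩ : ∃ i j : ℕ, i < j ∧ f^[i] x₀ = f^[j] x₀ := by
    obtain ⟨i, j, hne, he⟩ := Finite.exists_ne_map_eq_of_infinite fun i : ℕ => f^[i] x₀
    rcases lt_or_gt_of_ne hne with h | h
    · exact ⟨i, j, h, he⟩
    · exact ⟨j, i, h, he.symm⟩
  have hper : f^[i] x₀ ∈ Function.periodicPts f := by
    refine ⟨j - i, by omega, ?_⟩
    rw [Function.IsPeriodicPt, Function.IsFixedPt, ← Function.iterate_add_apply,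
      Nat.sub_add_cancel hij.le, he]
  set x := f^[i] x₀
  refine ⟨Function.minimalPeriod f x, fun m => (f^[m] x : {w // 0 < g w}),
    Function.minimalPeriod_pos_of_mem_periodicPts hper, fun m => (f^[m] x).2, fun m => ?_,
    fun m => ?_, ?_⟩
  · simp only [Function.iterate_succ_apply', hf]
  · simp only [Function.iterate_add_minimalPeriod_eq]
  · exact Subtype.val_injective.comp_injOn Function.iterate_injOn_Iio_minimalPeriod

/-- The flow of value one along a closed walk of darts. -/
def cycleFlow {W : Type*} (σ : W → W) (k : ℕ) (c : ℕ → W) (w : W) : ℝ :=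
  (if ∃ i < k, c i = w then 1 else 0) - (if ∃ i < k, c i = σ w then 1 else 0)

lemma cycleFlow_mem_flowSpace {W V : Type*} [Fintype W] {t : W → V} {σ : W → W}
    (hσ : Function.Involutive σ) {k : ℕ} {c : ℕ → W}
    (ht : ∀ i, t (c (i + 1)) = t (σ (c i))) (hper : ∀ i, c (i + k) = c i)
    (hinj : Set.InjOn c (Set.Iio k)) : cycleFlow σ k c ∈ flowSpace t σ := by
  refine mem_flowSpace.2 ⟨fun w => by simp [cycleFlow, hσ w], fun v => ?_⟩
  have hO : ∀ F : W → ℝ, ∑ w, (if ∃ i < k, c i = w then F w else 0)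
      = ∑ i ∈ Finset.range k, F (c i) := by
    intro F
    rw [← Finset.sum_filter, ← Finset.sum_image (f := F) (g := c) (s := Finset.range k)]
    · congr 1
      ext w
      simp
    · simpa using hinj
  have h1 : ∑ w, (if t w = v then cycleFlow σ k c w else 0)
      = ∑ w, (if ∃ i < k, c i = w then (if t w = v then (1 : ℝ) else 0) else 0)
        - ∑ w, (if ∃ i < k, c i = σ w then (if t (σ (σ w)) = v then (1 : ℝ) else 0) else 0) := by
    rw [← Finset.sum_sub_distrib]
    refine Finset.sum_congr rfl fun w _ => ?_
    rw [hσ w, cycleFlow]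
    split_ifs <;> simp
  rw [h1, hσ.bijective.sum_comp
    fun w => if ∃ i < k, c i = w then (if t (σ w) = v then (1 : ℝ) else 0) else 0, hO, hO]
  simp only [← ht]
  have h2 := Finset.sum_range_succ (fun i => if t (c i) = v then (1 : ℝ) else 0) k
  rw [Finset.sum_range_succ'] at h2
  have h3 := hper 0
  rw [zero_add] at h3
  simp only [h3] at h2
  linarith

/-- Flows are spanned by the flows along closed walks whose darts and reversed darts are
distinct. -/
lemma flowSpace_le_span {W V : Type*} [Fintype W] {t : W → V} {σ : W → W}
    (hσ : Function.Involutive σ) :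
    flowSpace t σ ≤ Submodule.span ℝ {h | ∃ (k : ℕ) (c : ℕ → W), 0 < k ∧
      (∀ i, t (c (i + 1)) = t (σ (c i))) ∧ (∀ i, c (i + k) = c i) ∧
      Set.InjOn c (Set.Iio k) ∧ (∀ i j, c i ≠ σ (c j)) ∧ h = cycleFlow σ k c} := by
  suffices H : ∀ (N : ℕ) (g : W → ℝ), g ∈ flowSpace t σ →
      (Finset.univ.filter fun w => g w ≠ 0).card ≤ N → g ∈ Submodule.span ℝ {h | ∃ (k : ℕ)
      (c : ℕ → W), 0 < k ∧ (∀ i, t (c (i + 1)) = t (σ (c i))) ∧ (∀ i, c (i + k) = c i) ∧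
      Set.InjOn c (Set.Iio k) ∧ (∀ i j, c i ≠ σ (c j)) ∧ h = cycleFlow σ k c} from
    fun g hg => H _ g hg le_rfl
  intro N
  induction N with
  | zero =>
    intro g _ hcard
    have : g = 0 := by
      ext w
      simpa using Finset.filter_eq_empty_iff.1 (Finset.card_eq_zero.1 (Nat.le_zero.1 hcard))
        (Finset.mem_univ w)
    rw [this]
    exact zero_mem _
  | succ N ih =>
    intro g hg hcard
    by_cases hg0 : g = 0
    · rw [hg0]; exact zero_mem _
    obtain ⟨k, c, hk, hpos, ht, hper, hinj⟩ := exists_positive_cycle hg hg0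
    have ha := (mem_flowSpace.1 hg).1
    have hne : ∀ i j, c i ≠ σ (c j) := by
      intro i j h
      have h1 := hpos i
      rw [h, ha] at h1
      linarith [hpos j]
    have hh := cycleFlow_mem_flowSpace hσ ht hper hinj
    have hval : cycleFlow σ k c (c 0) = 1 := by
      rw [cycleFlow, if_pos ⟨0, hk, rfl⟩, if_neg, sub_zero]
      rintro ⟨i, -, hi⟩
      exact hne _ _ hi
    have hsupp : ∀ w, g w = 0 → cycleFlow σ k c w = 0 := by
      intro w hw
      rw [cycleFlow, if_neg, if_neg, sub_zero]
      · rintro ⟨i, -, hi⟩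
        have := hpos i
        rw [hi, ha, hw] at this
        simp at this
      · rintro ⟨i, -, rfl⟩
        exact (hpos i).ne' hw
    have hrest := by
      refine ih (g - g (c 0) • cycleFlow σ k c) (sub_mem hg (Submodule.smul_mem _ _ hh)) (Nat.lt_succ_iff.1 (lt_of_lt_of_le
        (Finset.card_lt_card ((Finset.ssubset_iff_of_subset ?_).2 ⟨c 0, ?_, ?_⟩)) hcard))
      · intro w
        simp only [Finset.mem_filter, Finset.mem_univ, true_and]
        intro h1 h2
        exact h1 (by simp [h2, hsupp w h2])
      · simp [(hpos 0).ne']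
      · simp [hval]
    have := add_mem hrest (Submodule.smul_mem _ (g (c 0))
      (Submodule.subset_span ⟨k, c, hk, ht, hper, hinj, hne, rfl⟩))
    simpa using this

/-- Position `k` carries the last letter of `w` that differs from its final letter. -/
def IsPivot {m : ℕ} (w : Fin (m + 1) → Fin 3) (k : Fin (m + 1)) : Prop :=
  w k ≠ w (Fin.last m) ∧ ∀ l, k < l → w l = w (Fin.last m)

/-- Exchange of the letters `w k` and `w (Fin.last m)` from position `k` on. -/
def flipAt {m : ℕ} (w : Fin (m + 1) → Fin 3) (k : Fin (m + 1)) : Fin (m + 1) → Fin 3 :=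
  fun l => if l < k then w l else if l = k then w (Fin.last m) else w k

/-- The neighbour of `w` outside its elementary triangle, or `w` itself at the corners. -/
def bridge {m : ℕ} (w : Fin (m + 1) → Fin 3) : Fin (m + 1) → Fin 3 :=
  if h : ∃ k, IsPivot w k then flipAt w h.choose else w

lemma IsPivot.eq {m : ℕ} {w : Fin (m + 1) → Fin 3} {k l : Fin (m + 1)}
    (hk : IsPivot w k) (hl : IsPivot w l) : k = l := by
  rcases lt_trichotomy k l with h | h | h
  · exact absurd (hk.2 l h) hl.1
  · exact h
  · exact absurd (hl.2 k h) hk.1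

lemma IsPivot.lt_last {m : ℕ} {w : Fin (m + 1) → Fin 3} {k : Fin (m + 1)}
    (hk : IsPivot w k) : k < Fin.last m :=
  lt_of_le_of_ne (Fin.le_last k) fun h => hk.1 (by rw [h])

lemma IsPivot.bridge_eq {m : ℕ} {w : Fin (m + 1) → Fin 3} {k : Fin (m + 1)}
    (hk : IsPivot w k) : bridge w = flipAt w k := by
  have h : ∃ k, IsPivot w k := ⟨k, hk⟩
  rw [bridge, dif_pos h, h.choose_spec.eq hk]

lemma flipAt_of_lt {m : ℕ} (w : Fin (m + 1) → Fin 3) {k l : Fin (m + 1)} (h : l < k) :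
    flipAt w k l = w l := if_pos h

lemma flipAt_self {m : ℕ} (w : Fin (m + 1) → Fin 3) (k : Fin (m + 1)) :
    flipAt w k k = w (Fin.last m) := by simp [flipAt]

lemma flipAt_of_gt {m : ℕ} (w : Fin (m + 1) → Fin 3) {k l : Fin (m + 1)} (h : k < l) :
    flipAt w k l = w k := by simp [flipAt, h.not_gt, h.ne']

lemma IsPivot.flipAt {m : ℕ} {w : Fin (m + 1) → Fin 3} {k : Fin (m + 1)}
    (hk : IsPivot w k) : IsPivot (flipAt w k) k := by
  constructor
  · rw [flipAt_self, flipAt_of_gt w hk.lt_last]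
    exact hk.1.symm
  · intro l hl
    rw [flipAt_of_gt w hl, flipAt_of_gt w hk.lt_last]

lemma IsPivot.flipAt_flipAt {m : ℕ} {w : Fin (m + 1) → Fin 3} {k : Fin (m + 1)}
    (hk : IsPivot w k) : _root_.flipAt (_root_.flipAt w k) k = w := by
  ext1 l
  rcases lt_trichotomy l k with h | rfl | h
  · rw [flipAt_of_lt _ h, flipAt_of_lt _ h]
  · rw [flipAt_self, flipAt_of_gt w hk.lt_last]
  · rw [flipAt_of_gt _ h, flipAt_self, hk.2 l h]

lemma bridge_involutive {m : ℕ} : Function.Involutive (bridge (m := m)) := by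
  intro w
  by_cases h : ∃ k, IsPivot w k
  · obtain ⟨k, hk⟩ := h
    rw [hk.bridge_eq, hk.flipAt.bridge_eq, hk.flipAt_flipAt]
  · have : bridge w = w := dif_neg h
    rw [this, this]

lemma IsPivot.init_flipAt_ne {m : ℕ} {w : Fin (m + 1) → Fin 3} {k : Fin (m + 1)}
    (hk : IsPivot w k) : Fin.init (_root_.flipAt w k) ≠ Fin.init w := by
  intro h
  have := congrFun h (k.castPred hk.lt_last.ne)
  simp only [Fin.init, Fin.castSucc_castPred, flipAt_self] at this
  exact hk.1 this.symm

lemma bridge_eq_self_iff_not_exists {m : ℕ} {w : Fin (m + 1) → Fin 3} :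
    bridge w = w ↔ ¬ ∃ k, IsPivot w k := by
  refine ⟨?_, fun h => dif_neg h⟩
  rintro h ⟨k, hk⟩
  rw [hk.bridge_eq] at h
  exact hk.init_flipAt_ne (by rw [h])

lemma init_bridge_eq_iff {m : ℕ} {w : Fin (m + 1) → Fin 3} :
    Fin.init (bridge w) = Fin.init w ↔ bridge w = w := by
  refine ⟨fun h => bridge_eq_self_iff_not_exists.2 ?_, fun h => by rw [h]⟩
  rintro ⟨k, hk⟩
  rw [hk.bridge_eq] at h
  exact hk.init_flipAt_ne h

lemma bridge_eq_self_iff {m : ℕ} {w : Fin (m + 1) → Fin 3} :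
    bridge w = w ↔ ∃ a, w = fun _ => a := by
  rw [bridge_eq_self_iff_not_exists]
  constructor
  · intro h
    refine ⟨w (Fin.last m), ?_⟩
    by_contra hne
    obtain ⟨l, hl⟩ := Function.ne_iff.1 hne
    obtain ⟨k, hk, hmax⟩ := (Finset.univ.filter fun l => w l ≠ w (Fin.last m)).exists_max_image id
      ⟨l, by simpa using hl⟩
    refine h ⟨k, by simpa using hk, fun l hl => ?_⟩
    by_contra hcon
    exact absurd (hmax l (by simpa using hcon)) (not_le.2 hl)
  · rintro ⟨a, rfl⟩ ⟨k, hk⟩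
    exact hk.1 rfl

lemma card_fixed_bridge {m : ℕ} :
    Nat.card {w : Fin (m + 1) → Fin 3 // bridge w = w} = 3 := by
  have e : Fin 3 ≃ {w : Fin (m + 1) → Fin 3 // bridge w = w} :=
    Equiv.ofBijective (fun a => ⟨fun _ => a, bridge_eq_self_iff.2 ⟨a, rfl⟩⟩)
      ⟨fun a b h => congrFun (congrArg Subtype.val h) 0, fun ⟨w, hw⟩ => by
        obtain ⟨a, rfl⟩ := bridge_eq_self_iff.1 hw
        exact ⟨a, rfl⟩⟩
  rw [← Nat.card_congr e, Nat.card_fin]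

lemma adjHW_iff {m : ℕ} {w w' : Fin (m + 1) → Fin 3} :
    adjHW w w' ↔ (Fin.init w' = Fin.init w ∧ w' ≠ w) ∨ (w' = bridge w ∧ w' ≠ w) := by
  constructor
  · rintro ⟨k, hne, hlt, hgt, hgt'⟩
    have hww : w' ≠ w := fun h => hne (by rw [h])
    rcases (Fin.le_last k).lt_or_eq with hk | rfl
    · right
      refine ⟨?_, hww⟩
      have hp : IsPivot w k := ⟨by rw [hgt _ hk]; exact hne, fun l hl => by
        rw [hgt _ hl, hgt _ hk]⟩
      rw [hp.bridge_eq]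
      ext1 l
      rcases lt_trichotomy l k with h | rfl | h
      · rw [flipAt_of_lt _ h, hlt l h]
      · rw [flipAt_self, hgt _ hk]
      · rw [flipAt_of_gt _ h, hgt' l h]
    · left
      exact ⟨funext fun l => (hlt _ (Fin.castSucc_lt_last l)).symm, hww⟩
  · rintro (⟨h, hne⟩ | ⟨h, hne⟩)
    · have hlt : ∀ l, l < Fin.last m → w l = w' l := fun l hl => by
        have := congrFun h (l.castPred hl.ne)
        simpa [Fin.init] using this.symm
      refine ⟨Fin.last m, fun he => hne (funext fun l => ?_), hlt,
        fun l hl => absurd hl (Fin.le_last l).not_gt,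
        fun l hl => absurd hl (Fin.le_last l).not_gt⟩
      rcases (Fin.le_last l).lt_or_eq with hl | rfl
      · exact (hlt l hl).symm
      · exact he.symm
    · rw [h, Ne, bridge_eq_self_iff_not_exists, not_not] at hne
      obtain ⟨k, hk⟩ := hne
      rw [h, hk.bridge_eq]
      refine ⟨k, ?_, fun l hl => (flipAt_of_lt _ hl).symm, fun l hl => ?_,
        fun l hl => flipAt_of_gt _ hl⟩
      · rw [flipAt_self]; exact hk.1
      · rw [flipAt_self, hk.2 l hl]

lemma eqvGen_adjHW {m : ℕ} (u v : Fin m → Fin 3) : Relation.EqvGen adjHW u v := by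
  induction m with
  | zero => rw [Subsingleton.elim u v]; exact .refl _
  | succ m ih =>
    have hcons : ∀ (a : Fin 3) (x y : Fin m → Fin 3),
        Relation.EqvGen adjHW (Fin.cons a x : Fin (m + 1) → Fin 3) (Fin.cons a y) := by
      intro a x y
      induction ih x y with
      | rel x y h =>
        obtain ⟨k, h1, h2, h3, h4⟩ := h
        refine .rel _ _ ⟨k.succ, by simpa using h1, fun l => ?_, fun l => ?_, fun l => ?_⟩
        all_goals refine Fin.cases ?_ (fun l => ?_) l
        · simp
        · simpa using h2 l
        · simp
        · simpa using h3 l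
        · simp
        · simpa using h4 l
      | refl x => exact .refl _
      | symm x y _ h => exact .symm _ _ h
      | trans x y z _ _ h1 h2 => exact .trans _ _ _ h1 h2
    rw [← Fin.cons_self_tail u, ← Fin.cons_self_tail v]
    by_cases hab : u 0 = v 0
    · rw [hab]; exact hcons _ _ _
    · refine .trans _ _ _ (hcons _ _ fun _ => v 0) (.trans _ _ _ (.rel _ (Fin.cons (v 0)
        fun _ => u 0) ⟨0, ?_, ?_, ?_, ?_⟩) (hcons _ _ _))
      · simpa using hab
      · simp
      all_goals
        intro l hl
        obtain ⟨l, rfl⟩ := Fin.exists_succ_eq.2 hl.ne'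
        simp

lemma eqvGen_init_bridge {m : ℕ} (u v : Fin m → Fin 3) :
    Relation.EqvGen (fun a b => ∃ w : Fin (m + 1) → Fin 3,
      Fin.init w = a ∧ Fin.init (bridge w) = b) u v := by
  refine (eqvGen_adjHW u v).mono ?_
  rintro a b ⟨k, h1, h2, h3, h4⟩
  have hp : IsPivot (Fin.snoc a (b k) : Fin (m + 1) → Fin 3) k.castSucc := by
    refine ⟨by simpa using h1, fun l => ?_⟩
    refine Fin.lastCases (by simp) (fun l hl => ?_) l
    simpa using h3 l (by simpa using hl)
  refine ⟨Fin.snoc a (b k), by simp, ?_⟩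
  rw [hp.bridge_eq]
  ext1 l
  rw [Fin.init]
  rcases lt_trichotomy l k with h | rfl | h
  · rw [flipAt_of_lt _ (by simpa using h)]
    simpa using h2 l h
  · rw [flipAt_self]
    simp
  · rw [flipAt_of_gt _ (by simpa using h)]
    simpa using (h4 l h).symm

lemma sum_adjHW {m : ℕ} (w : Fin (m + 1) → Fin 3) (f : (Fin (m + 1) → Fin 3) → ℝ) :
    ∑ w', (if adjHW w w' then f w' else 0) = divergence Fin.init f (Fin.init w) - f w
      + f (bridge w) - (if bridge w = w then f w else 0) := by
  have h : ∀ w', (if adjHW w w' then f w' else 0)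
      = (if Fin.init w' = Fin.init w then f w' else 0) - (if w' = w then f w' else 0)
        + (if w' = bridge w then f w' else 0)
        - (if w' = w then (if bridge w = w then f w' else 0) else 0) := by
    intro w'
    rw [adjHW_iff]
    by_cases h1 : w' = w
    · subst h1
      by_cases h2 : bridge w' = w'
      · simp [h2]
      · simp [h2, Ne.symm h2]
    · by_cases h2 : w' = bridge w
      · have h3 : Fin.init w' ≠ Fin.init w := by
          rw [h2] at h1 ⊢
          exact fun h => h1 (init_bridge_eq_iff.1 h)
        have h4 : bridge w ≠ w := h2 ▸ h1
        simp [h2, h2 ▸ h3, h4]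
      · simp [h1, h2]
  simp only [h, Finset.sum_add_distrib, Finset.sum_sub_distrib, divergence_apply,
    Finset.sum_ite_eq', Finset.mem_univ, if_true]
  congr!

lemma divergence_init_one {m : ℕ} (v : Fin m → Fin 3) :
    divergence (Fin.init : (Fin (m + 1) → Fin 3) → Fin m → Fin 3) (fun _ => 1) v = 3 := by
  rw [divergence_apply, ← (Fin.snocEquiv fun _ => Fin 3).sum_comp, Fintype.sum_prod_type]
  simp [Fin.snocEquiv]

lemma lapHW_mulVec {m : ℕ} (g : (Fin (m + 1) → Fin 3) → ℝ) (w : Fin (m + 1) → Fin 3) :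
    (lapHW (m + 1)).mulVec g w
      = 3⁻¹ * (divergence Fin.init g (Fin.init w) + g (bridge w) - 4 * g w) := by
  have hdeg := sum_adjHW w fun _ => 1
  rw [divergence_init_one] at hdeg
  have h : (lapHW (m + 1)).mulVec g w = 3⁻¹ * (∑ w', (if adjHW w w' then g w' else 0)
      - (∑ w', if adjHW w w' then (1 : ℝ) else 0) * g w) := by
    simp only [Matrix.mulVec, dotProduct, lapHW, Matrix.of_apply, mul_assoc, ← Finset.mul_sum,
      sub_mul, Finset.sum_sub_distrib, ite_mul, one_mul, zero_mul, Finset.sum_ite_eq',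
      Finset.mem_univ, if_true]
  rw [h, hdeg, sum_adjHW]
  split_ifs <;> ring

lemma eigenspace_lapHW (m : ℕ) :
    Module.End.eigenspace (Matrix.mulVecLin (lapHW (m + 1))) (-5/3)
      = flowSpace (Fin.init : (Fin (m + 1) → Fin 3) → Fin m → Fin 3) bridge := by
  ext g
  rw [Module.End.mem_eigenspace_iff, Matrix.mulVecLin_apply, funext_iff,
    mem_flowSpace_iff_divergence_add bridge_involutive eqvGen_init_bridge Fintype.card_pos]
  refine forall_congr' fun w => ?_
  rw [lapHW_mulVec, Pi.smul_apply, smul_eq_mul]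
  constructor <;> intro h <;> linarith

lemma finrank_eigenspace_lapHW (m : ℕ) :
    Module.finrank ℝ (Module.End.eigenspace (Matrix.mulVecLin (lapHW (m + 1))) (-5/3))
      = (3 ^ m - 1) / 2 := by
  have h := two_mul_finrank_flowSpace
    (t := (Fin.init : (Fin (m + 1) → Fin 3) → Fin m → Fin 3)) bridge_involutive eqvGen_init_bridge
  rw [← eigenspace_lapHW, card_fixed_bridge] at h
  simp only [Fintype.card_fun, Fintype.card_fin, pow_succ] at h
  omega

lemma isAltCycleFn_cycleFlow {m k : ℕ} {c : ℕ → Fin (m + 1) → Fin 3} (hk : 0 < k)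
    (ht : ∀ i, (Fin.init (c (i + 1)) : Fin m → Fin 3) = Fin.init (bridge (c i)))
    (hper : ∀ i, c (i + k) = c i) (hinj : Set.InjOn c (Set.Iio k))
    (hne : ∀ i j, c i ≠ bridge (c j)) : IsAltCycleFn (m + 1) (cycleFlow bridge k c) := by
  have hk2 : 2 ≤ k := by
    by_contra hlt
    obtain rfl : k = 1 := by omega
    have h := ht 0
    rw [hper] at h
    exact hne 0 0 (init_bridge_eq_iff.1 h.symm).symm
  have : NeZero (2 * k) := ⟨by omega⟩
  let p : ℕ → Fin (m + 1) → Fin 3 := fun i => if Even i then c (i / 2) else bridge (c (i / 2))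
  have hpeven : ∀ i, p (2 * i) = c i := fun i => by simp [p]
  have hpodd : ∀ i, p (2 * i + 1) = bridge (c i) := fun i => by
    have : (2 * i + 1) / 2 = i := by omega
    simp [p, this]
  have hpper : Function.Periodic p (2 * k) := by
    intro i
    obtain ⟨j, rfl | rfl⟩ := i.even_or_odd'
    · rw [← mul_add, hpeven, hpeven, hper]
    · rw [show 2 * j + 1 + 2 * k = 2 * (j + k) + 1 by ring, hpodd, hpodd, hper]
  have hpadj : ∀ i, adjHW (p i) (p (i + 1)) := by
    intro i
    rw [adjHW_iff]
    obtain ⟨j, rfl | rfl⟩ := i.even_or_odd'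
    · rw [hpeven, hpodd]
      exact Or.inr ⟨rfl, (hne j j).symm⟩
    · rw [hpodd, show 2 * j + 1 + 1 = 2 * (j + 1) by ring, hpeven]
      exact Or.inl ⟨ht j, hne _ _⟩
  have hpinj : ∀ i j, i < 2 * k → j < 2 * k → p i = p j → i = j := by
    intro i j hi hj h
    obtain ⟨a, rfl | rfl⟩ := i.even_or_odd' <;> obtain ⟨b, rfl | rfl⟩ := j.even_or_odd' <;>
      simp only [hpeven, hpodd] at h
    · rw [hinj (show a < k by omega) (show b < k by omega) h]
    · exact absurd h (hne _ _)
    · exact absurd h.symm (hne _ _)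
    · rw [hinj (show a < k by omega) (show b < k by omega) (bridge_involutive.injective h)]
  refine ⟨k, hk2, fun i => p i.val, fun i j h => ZMod.val_injective _
    (hpinj _ _ (ZMod.val_lt i) (ZMod.val_lt j) h), fun i => ?_, fun w hw => ?_, fun i => ?_⟩
  · have : (i + 1).val = (i.val + 1) % (2 * k) := by
      have : Fact (1 < 2 * k) := ⟨by omega⟩
      rw [ZMod.val_add, ZMod.val_one]
    beta_reduce
    rw [this, hpper.map_mod_nat]
    exact hpadj _
  · have hrange : ∀ j < 2 * k, p j ≠ w := fun j hj h =>
      hw ⟨(j : ZMod (2 * k)), by simpa [ZMod.val_natCast, Nat.mod_eq_of_lt hj] using h⟩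
    rw [cycleFlow, if_neg, if_neg, sub_zero]
    · rintro ⟨i, hi, h⟩
      exact hrange (2 * i + 1) (by omega) (by rw [hpodd, h, bridge_involutive])
    · rintro ⟨i, hi, h⟩
      exact hrange (2 * i) (by omega) (by rw [hpeven, h])
  · have hi := ZMod.val_lt i
    beta_reduce
    generalize i.val = j at hi
    obtain ⟨a, rfl | rfl⟩ := j.even_or_odd'
    · rw [hpeven, cycleFlow, if_pos ⟨a, by omega, rfl⟩, if_neg]
      · simp
      · rintro ⟨b, -, h⟩
        exact hne _ _ h
    · rw [hpodd, cycleFlow, if_neg, if_pos ⟨a, by omega, (bridge_involutive _).symm⟩]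
      · simp [pow_succ]
      · rintro ⟨b, -, h⟩
        exact hne _ _ h

/-- For `n ≥ 2`, `-5/3` is an eigenvalue of `Δ^H_n` with multiplicity
`(3^{n-1}-1)/2`, and the eigenspace has a basis of functions taking alternating
values `±1` around cycles of `H_n` strictly longer than the elementary triangles. -/
theorem H_eigenvalue_neg_five_thirds (n : ℕ) (hn : 2 ≤ n) :
    Module.End.HasEigenvalue (Matrix.mulVecLin (lapHW n)) (-5/3) ∧
    Module.finrank ℝ (Module.End.eigenspace (Matrix.mulVecLin (lapHW n)) (-5/3))
      = (3 ^ (n - 1) - 1) / 2 ∧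
    ∃ b : Fin ((3 ^ (n - 1) - 1) / 2) → ((Fin n → Fin 3) → ℝ),
      (∀ i, IsAltCycleFn n (b i)) ∧ LinearIndependent ℝ b ∧
      ∀ g : (Fin n → Fin 3) → ℝ,
        g ∈ Module.End.eigenspace (Matrix.mulVecLin (lapHW n)) (-5/3) ↔
        g ∈ Submodule.span ℝ (Set.range b) := by
  obtain ⟨m, rfl⟩ : ∃ m, n = m + 1 := ⟨n - 1, by omega⟩
  have hrank := finrank_eigenspace_lapHW m
  simp only [Nat.add_sub_cancel]
  refine ⟨?_, hrank, ?_⟩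
  · change Module.End.eigenspace (Matrix.mulVecLin (lapHW (m + 1))) (-5/3) ≠ ⊥
    intro hbot
    rw [hbot, finrank_bot] at hrank
    have : 3 ^ 1 ≤ 3 ^ m := Nat.pow_le_pow_right (by norm_num) (by omega)
    omega
  · have hspan : Submodule.span ℝ {h | IsAltCycleFn (m + 1) h ∧
        h ∈ flowSpace (Fin.init : (Fin (m + 1) → Fin 3) → Fin m → Fin 3) bridge}
        = Module.End.eigenspace (Matrix.mulVecLin (lapHW (m + 1))) (-5/3) := by
      rw [eigenspace_lapHW]
      refine le_antisymm (Submodule.span_le.2 fun h hh => hh.2)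
        ((flowSpace_le_span bridge_involutive).trans (Submodule.span_mono ?_))
      rintro h ⟨k, c, hk, ht, hper, hinj, hne, rfl⟩
      exact ⟨isAltCycleFn_cycleFlow hk ht hper hinj hne,
        cycleFlow_mem_flowSpace bridge_involutive ht hper hinj⟩
    obtain ⟨s, hs, hss, hli⟩ := exists_linearIndependent ℝ {h | IsAltCycleFn (m + 1) h ∧
      h ∈ flowSpace (Fin.init : (Fin (m + 1) → Fin 3) → Fin m → Fin 3) bridge}
    have : Fintype s := hli.setFinite.fintype
    have hcard : Fintype.card s = (3 ^ m - 1) / 2 := by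
      rw [← hrank, ← hspan, ← hss, ← finrank_span_eq_card hli, Subtype.range_coe]
    let e := (Fintype.equivFinOfCardEq hcard).symm
    refine ⟨fun i => e i, fun i => (hs (e i).2).1, hli.comp e e.injective, fun g => ?_⟩
    have : Set.range (fun i => (e i : (Fin (m + 1) → Fin 3) → ℝ)) = s := by
      rw [← Function.comp_def Subtype.val e, e.surjective.range_comp, Subtype.range_coe]
    have hg : g ∈ Submodule.span ℝ s ↔ g ∈ Submodule.span ℝ (Set.range fun i => (e i).1) := by
      rw [this]
    rw [← hspan, ← hss]
    exact hg
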